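/- arXiv:0712.2112 — 2 statements merged into one kernel-verified Lean document; each statement's English description precedes it below -/
import Mathlib

section
/- For every nonempty perfect set P ⊆ ℝ there exists a strictly increasing sequence of natural numbers (n_k) such that for every y ∈ ℝ there exists p ∈ P with ‖n_k(p − y)‖ ≤ 2^{-k} for all k. -/
open MeasureTheory Filter Set

/-- Distance from a real number to the nearest integer. -/
noncomputable def nintDist (x : ℝ) : ℝ := |x - round x|

/-- `E` is a Dirichlet set. -/
def IsDirichlet (E : Set ℝ) : Prop :=
  ∃ n : ℕ → ℕ, StrictMono n ∧ ∀ x ∈ E, ∀ k : ℕ, nintDist (n k * x) ≤ (1/2) ^ k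

/-- `E` is a pseudo-Dirichlet set. -/
def IsPseudoDirichlet (E : Set ℝ) : Prop :=
  ∃ n : ℕ → ℕ, StrictMono n ∧ ∀ x ∈ E, ∀ᶠ k in atTop, nintDist (n k * x) ≤ (1/2) ^ k

/-- `E` is an Arbault set. -/
def IsArbault (E : Set ℝ) : Prop :=
  ∃ n : ℕ → ℕ, StrictMono n ∧ ∀ x ∈ E,
    Tendsto (fun k => nintDist (n k * x)) atTop (nhds 0)

/-- `E` is an N-set. -/
def IsNSet (E : Set ℝ) : Prop :=
  ∃ a : ℕ → ℝ, (∀ n, 0 ≤ a n) ∧ ¬ Summable a ∧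
    ∀ x ∈ E, Summable (fun n => a n * nintDist (n * x))

/-- `s` is an Fσ set: a countable union of closed sets. -/
def IsFsigma (s : Set ℝ) : Prop :=
  ∃ f : ℕ → Set ℝ, (∀ n, IsClosed (f n)) ∧ s = ⋃ n, f n

/-- Multiples of a nonzero real `d` come within `|d|` of any real modulo one before they leave
the unit interval. -/
theorem exists_nat_mul_near_mod_one {d : ℝ} (hd : d ≠ 0) (r : ℝ) :
    ∃ (m : ℕ) (z : ℤ), m * |d| ≤ 1 ∧ |m * d - r - z| ≤ |d| := by
  have key (d r : ℝ) (hd : 0 < d) :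
      ∃ (m : ℕ) (z : ℤ), m * d ≤ 1 ∧ |m * d - r - z| ≤ d := by
    have hq : 0 ≤ Int.fract r / d := div_nonneg (Int.fract_nonneg r) hd.le
    have h₁ : (⌊Int.fract r / d⌋₊ : ℝ) * d ≤ Int.fract r :=
      (le_div_iff₀ hd).1 (Nat.floor_le hq)
    have h₂ : Int.fract r < (⌊Int.fract r / d⌋₊ + 1 : ℝ) * d :=
      (div_lt_iff₀ hd).1 (Nat.lt_floor_add_one _)
    have h₃ := Int.floor_add_fract r
    refine ⟨⌊Int.fract r / d⌋₊, -⌊r⌋, h₁.trans (Int.fract_lt_one r).le, ?_⟩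
    push_cast
    rw [abs_le]
    constructor <;> linarith
  rcases hd.lt_or_gt with h | h
  · obtain ⟨m, z, h₁, h₂⟩ := key (-d) (-r) (neg_pos.2 h)
    refine ⟨m, -z, by rwa [abs_of_neg h], ?_⟩
    rw [abs_of_neg h, ← abs_neg]
    convert h₂ using 2
    push_cast
    ring
  · simpa only [abs_of_pos h] using key d r h

/-- In a set without isolated points, finitely many points can be perturbed so that arbitrarily
large common multiples of the perturbations approximate prescribed targets modulo one. -/
theorem exists_perturbation_mul_near_mod_one {P : Set ℝ}
    (hP : ∀ x : P, ∀ δ > 0, ∃ p : P, (p : ℝ) ≠ x ∧ |(p : ℝ) - x| < δ)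
    {ι : Type*} (s : Finset ι) (x : ι → P) (a : ι → ℝ) :
    ∀ ε > 0, ∀ δ > 0, ∃ p : ι → P, (∀ i ∈ s, |(p i : ℝ) - x i| < δ) ∧
      ∀ N : ℕ, ∃ n ≥ N, ∀ i ∈ s, ∃ z : ℤ, |n * ((p i : ℝ) - x i) - a i - z| < ε := by
  classical
  induction s using Finset.induction_on with
  | empty => exact fun ε _ δ _ => ⟨x, by simp, fun N => ⟨N, le_rfl, by simp⟩⟩
  | insert j s hj ih =>
    intro ε hε δ hδ
    obtain ⟨q, hq, hqδ⟩ := hP (x j) (min δ ε) (lt_min hδ hε)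
    have hd : (q : ℝ) - x j ≠ 0 := sub_ne_zero.2 hq
    have hd' := abs_pos.2 hd
    obtain ⟨p, hp, hn⟩ := ih (ε / 2) (half_pos hε) (min δ (|(q : ℝ) - x j| * (ε / 2)))
      (lt_min hδ (by positivity))
    have hne : ∀ i ∈ s, i ≠ j := fun i hi h => hj (h ▸ hi)
    refine ⟨Function.update p j q, ?_, fun N => ?_⟩
    · intro i hi
      rcases Finset.mem_insert.1 hi with rfl | hi
      · simpa using hqδ.trans_le (min_le_left _ _)
      · rw [Function.update_of_ne (hne i hi)]
        exact (hp i hi).trans_le (min_le_left _ _)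
    obtain ⟨n, hnN, hn⟩ := hn N
    obtain ⟨m, z, hm, hz⟩ := exists_nat_mul_near_mod_one hd (a j - n * (q - x j))
    refine ⟨n + m, hnN.trans (Nat.le_add_right _ _), fun i hi => ?_⟩
    rcases Finset.mem_insert.1 hi with rfl | hi
    · refine ⟨z, ?_⟩
      rw [Function.update_self]
      refine lt_of_eq_of_lt ?_ (hz.trans_lt (hqδ.trans_le (min_le_right _ _)))
      congr 1
      push_cast
      ring
    · obtain ⟨w, hw⟩ := hn i hi
      refine ⟨w, ?_⟩
      rw [Function.update_of_ne (hne i hi)]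
      have hmp : |m * ((p i : ℝ) - x i)| ≤ ε / 2 := by
        rw [abs_mul, Nat.abs_cast]
        calc (m : ℝ) * |(p i : ℝ) - x i|
            ≤ m * (|(q : ℝ) - x j| * (ε / 2)) := by
              gcongr
              exact ((hp i hi).trans_le (min_le_right _ _)).le
          _ = m * |(q : ℝ) - x j| * (ε / 2) := by ring
          _ ≤ 1 * (ε / 2) := by gcongr
          _ = ε / 2 := one_mul _
      calc |((n + m : ℕ) : ℝ) * ((p i : ℝ) - x i) - a i - w|
          = |(n * ((p i : ℝ) - x i) - a i - w) + m * ((p i : ℝ) - x i)| := by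
            congr 1
            push_cast
            ring
        _ ≤ _ := abs_add_le _ _
        _ < ε := by linarith

/-- A finite subset of a set without isolated points can be refined to a finite set which, near
every original point, meets every residue modulo one after scaling by a common large integer. -/
theorem exists_finset_refinement_mul_near_mod_one {P : Set ℝ}
    (hP : ∀ x : P, ∀ δ > 0, ∃ p : P, (p : ℝ) ≠ x ∧ |(p : ℝ) - x| < δ)
    (F : Finset P) {ε δ : ℝ} (hε : 0 < ε) (hδ : 0 < δ) (N : ℕ) :
    ∃ (F' : Finset P) (n : ℕ), N < n ∧ ∀ y : ℝ, ∀ x ∈ F, ∃ x' ∈ F',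
      |(x' : ℝ) - x| < δ ∧ ∃ z : ℤ, |n * ((x' : ℝ) - y) - z| ≤ ε := by
  classical
  obtain ⟨M, hM⟩ := exists_nat_gt (2 / ε)
  have hM₀ : (0 : ℝ) < M := (by positivity : 0 < 2 / ε).trans hM
  have hMε : 1 / (M : ℝ) ≤ ε / 2 := by
    rw [div_le_iff₀ hM₀]
    rw [div_lt_iff₀ hε] at hM
    linarith
  obtain ⟨p, hp, hn⟩ := exists_perturbation_mul_near_mod_one hP (F ×ˢ Finset.range M)
    Prod.fst (fun i => (i.2 : ℝ) / M) (ε / 2) (half_pos hε) δ hδ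
  obtain ⟨n, hnN, hn⟩ := hn (N + 1)
  refine ⟨(F ×ˢ Finset.range M).image p, n, hnN, fun y x hx => ?_⟩
  have hr₀ := Int.fract_nonneg (n * (y - x))
  have hr := Int.floor_add_fract (n * (y - x))
  set r := Int.fract (n * (y - x))
  have h₁ : (⌊r * M⌋₊ : ℝ) ≤ r * M := Nat.floor_le (by positivity)
  have h₂ : r * M < ⌊r * M⌋₊ + 1 := Nat.lt_floor_add_one _
  have hi : (x, ⌊r * M⌋₊) ∈ F ×ˢ Finset.range M := by
    refine Finset.mem_product.2 ⟨hx, Finset.mem_range.2 ?_⟩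
    have : r * M < 1 * M := mul_lt_mul_of_pos_right (Int.fract_lt_one _) hM₀
    exact_mod_cast h₁.trans_lt (this.trans_eq (one_mul _))
  obtain ⟨z, hz⟩ := hn _ hi
  refine ⟨_, Finset.mem_image_of_mem p hi, hp _ hi, z - ⌊n * (y - x)⌋, ?_⟩
  have h₃ : (⌊r * M⌋₊ : ℝ) / M ≤ r := (div_le_iff₀ hM₀).2 h₁
  have h₄ : r < (⌊r * M⌋₊ : ℝ) / M + 1 / M := by
    rw [← add_div]
    exact (lt_div_iff₀ hM₀).2 h₂
  dsimp only at hz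
  rw [abs_lt] at hz
  push_cast
  rw [abs_le]
  constructor <;> linarith

theorem Perfect.exists_ne_abs_sub_lt {P : Set ℝ} (hP : Perfect P) (x : P) {δ : ℝ}
    (hδ : 0 < δ) : ∃ p : P, (p : ℝ) ≠ x ∧ |(p : ℝ) - x| < δ := by
  obtain ⟨p, ⟨hpδ, hp⟩, hpx⟩ :=
    accPt_iff_nhds.1 (hP.acc x x.2) _ (Metric.ball_mem_nhds (x : ℝ) hδ)
  exact ⟨⟨p, hp⟩, hpx, hpδ⟩

theorem stmt2 (P : Set ℝ) (hP : Perfect P) (hne : P.Nonempty) :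
    ∃ n : ℕ → ℕ, StrictMono n ∧
      ∀ y : ℝ, ∃ p ∈ P, ∀ k : ℕ, nintDist (n k * (p - y)) ≤ (1/2) ^ k := by
  obtain ⟨x₀, hx₀⟩ := hne
  have step (k : ℕ) (s : Finset P × ℕ) : ∃ t : Finset P × ℕ, s.2 < t.2 ∧
      ∀ y : ℝ, ∀ x ∈ s.1, ∃ x' ∈ t.1, |(x' : ℝ) - x| < (1 / 2) ^ k / (4 * (s.2 + 1)) ∧
        ∃ z : ℤ, |t.2 * ((x' : ℝ) - y) - z| ≤ (1 / 2) ^ (k + 1) / 2 := by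
    obtain ⟨F', n, h⟩ := exists_finset_refinement_mul_near_mod_one
      (fun x δ hδ => hP.exists_ne_abs_sub_lt x hδ) s.1
      (ε := (1 / 2) ^ (k + 1) / 2) (δ := (1 / 2) ^ k / (4 * (s.2 + 1)))
      (by positivity) (by positivity) s.2
    exact ⟨(F', n), h⟩
  choose next hlt hnext using step
  let S : ℕ → Finset P × ℕ := fun k => Nat.rec ({⟨x₀, hx₀⟩}, 0) next k
  have hmono : StrictMono fun k => (S k).2 := strictMono_nat_of_lt_succ fun k => hlt k (S k)
  refine ⟨fun k => (S k).2, hmono, fun y => ?_⟩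
  choose g hgmem hgdist hgint using fun k => hnext k (S k) y
  let u : (k : ℕ) → {x // x ∈ (S k).1} := fun k =>
    Nat.rec ⟨⟨x₀, hx₀⟩, Finset.mem_singleton_self _⟩
      (fun k x => ⟨g k x.1 x.2, hgmem k x.1 x.2⟩) k
  let v : ℕ → ℝ := fun k => ((u k).1 : ℝ)
  have hvdist (k : ℕ) : |v (k + 1) - v k| < (1 / 2) ^ k / (4 * ((S k).2 + 1)) :=
    hgdist k (u k).1 (u k).2
  have hvint (k : ℕ) : ∃ z : ℤ, |(S k).2 * (v k - y) - z| ≤ (1 / 2) ^ k / 2 := by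
    cases k with
    | zero => exact ⟨0, by simp [S]⟩
    | succ k => exact hgint k (u k).1 (u k).2
  have hgeom (k i : ℕ) : dist (v (k + i)) (v (k + (i + 1))) ≤
      (1 / 2) ^ k / (2 * ((S k).2 + 1)) / 2 / 2 ^ i := by
    have hle : ((S k).2 : ℝ) ≤ (S (k + i)).2 :=
      Nat.cast_le.2 (hmono.monotone (Nat.le_add_right k i))
    rw [dist_comm, Real.dist_eq]
    calc |v (k + (i + 1)) - v (k + i)|
        ≤ (1 / 2) ^ (k + i) / (4 * ((S (k + i)).2 + 1)) := (hvdist (k + i)).le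
      _ ≤ (1 / 2) ^ (k + i) / (4 * ((S k).2 + 1)) := by gcongr
      _ = _ := by
        rw [pow_add, one_div_pow (2 : ℝ) i]
        field_simp
        norm_num
  have hcauchy : CauchySeq v :=
    cauchySeq_of_le_geometric_two (C := (1 / 2) ^ 0 / (2 * ((S 0).2 + 1)))
      fun i => by simpa only [zero_add] using hgeom 0 i
  obtain ⟨p, hp⟩ := cauchySeq_tendsto_of_complete hcauchy
  refine ⟨p, hP.closed.mem_of_tendsto hp (Eventually.of_forall fun k => (u k).1.2),
    fun k => ?_⟩
  have hpk : |v k - p| ≤ (1 / 2) ^ k / (2 * ((S k).2 + 1)) :=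
    dist_le_of_le_geometric_two_of_tendsto₀ (f := fun i => v (k + i)) (hgeom k)
      (by simpa only [add_comm] using (tendsto_add_atTop_iff_nat k).2 hp)
  obtain ⟨z, hz⟩ := hvint k
  have hscaled : |(S k).2 * (p - v k)| ≤ (1 / 2) ^ k / 2 := by
    rw [abs_mul, Nat.abs_cast, abs_sub_comm]
    calc ((S k).2 : ℝ) * |v k - p|
        ≤ ((S k).2 + 1) * ((1 / 2) ^ k / (2 * ((S k).2 + 1))) := by gcongr; linarith
      _ = _ := by field_simp
  calc nintDist ((S k).2 * (p - y))
      ≤ |(S k).2 * (p - y) - z| := round_le _ z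
    _ = |(S k).2 * (p - v k) + ((S k).2 * (v k - y) - z)| := by congr 1; ring
    _ ≤ _ := abs_add_le _ _
    _ ≤ (1 / 2) ^ k := by linarith
end

section
/- There is no perfect permitted set for the family of N-sets: for every nonempty perfect set P ⊆ ℝ there exists an N-set E such that P ∪ E is not an N-set. -/
open MeasureTheory Filter Set

open Topology in
theorem tendsto_geom_average_zero {z : ℂ} (hz : ‖z‖ = 1) (hz1 : z ≠ 1) :
    Tendsto (fun N : ℕ => (N : ℝ)⁻¹ • ∑ n ∈ Finset.range N, z ^ n) atTop (𝓝 0) := by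
  have hb : ∀ N : ℕ, ‖(N : ℝ)⁻¹ • ∑ n ∈ Finset.range N, z ^ n‖ ≤ (N : ℝ)⁻¹ * (2 / ‖z - 1‖) := by
    intro N
    rw [norm_smul, geom_sum_eq hz1, norm_div, Real.norm_of_nonneg (by positivity)]
    gcongr
    calc ‖z ^ N - 1‖ ≤ ‖z ^ N‖ + ‖(1 : ℂ)‖ := norm_sub_le _ _
      _ = 2 := by rw [norm_pow, hz]; norm_num
  refine squeeze_zero_norm hb ?_
  simpa using (tendsto_inv_atTop_nhds_zero_nat (𝕜 := ℝ)).mul_const (2 / ‖z - 1‖)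

theorem UnitAddTorus.mFourier_nsmul {ι : Type*} [Fintype ι] (k : ι → ℤ) (n : ℕ)
    (x : UnitAddTorus ι) : mFourier k (n • x) = mFourier k x ^ n := by
  simp only [mFourier, ContinuousMap.coe_mk, Pi.smul_apply, fourier_apply, ← Finset.prod_pow]
  refine Finset.prod_congr rfl fun i _ => ?_
  rw [smul_comm, AddCircle.toCircle_nsmul, Circle.coe_pow]

theorem UnitAddTorus.mFourier_add_apply {ι : Type*} [Fintype ι] (k : ι → ℤ)
    (x y : UnitAddTorus ι) : mFourier k (x + y) = mFourier k x * mFourier k y := by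
  simp only [mFourier, ContinuousMap.coe_mk, Pi.add_apply, fourier_apply,
    ← Finset.prod_mul_distrib]
  refine Finset.prod_congr rfl fun i _ => ?_
  rw [smul_add, AddCircle.toCircle_add, Circle.coe_mul]

theorem UnitAddTorus.norm_mFourier_apply {ι : Type*} [Fintype ι] (k : ι → ℤ)
    (x : UnitAddTorus ι) : ‖mFourier k x‖ = 1 := by
  simp only [mFourier, ContinuousMap.coe_mk, fourier_apply, norm_prod, Circle.norm_coe,
    Finset.prod_const_one]

theorem isProbabilityMeasure_volume_unitAddTorus (ι : Type*) [Fintype ι] :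
    IsProbabilityMeasure (volume : Measure (UnitAddTorus ι)) := by
  have : IsProbabilityMeasure (volume : Measure UnitAddCircle) := ⟨by simp⟩
  unfold UnitAddTorus
  infer_instance

open Topology in
/-- Weyl's equidistribution theorem on the torus: if no nontrivial character is trivial at `x`,
then the multiples of `x` are equidistributed. -/
theorem UnitAddTorus.tendsto_average {ι : Type*} [Fintype ι] (x : UnitAddTorus ι)
    (hx : ∀ k : ι → ℤ, k ≠ 0 → mFourier k x ≠ 1) (f : C(UnitAddTorus ι, ℂ)) :
    Tendsto (fun N : ℕ => (N : ℝ)⁻¹ • ∑ n ∈ Finset.range N, f (n • x)) atTop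
      (𝓝 (∫ z, f z)) := by
  have := isProbabilityMeasure_volume_unitAddTorus ι
  have hint : ∀ g : C(UnitAddTorus ι, ℂ), Integrable g := fun g =>
    g.continuous.integrable_of_hasCompactSupport (HasCompactSupport.of_compactSpace _)
  have hspan : ∀ g ∈ Submodule.span ℂ (range (mFourier (d := ι))),
      Tendsto (fun N : ℕ => (N : ℝ)⁻¹ • ∑ n ∈ Finset.range N, g (n • x)) atTop
        (𝓝 (∫ z, g z)) := by
    intro g hg
    induction hg using Submodule.span_induction with
    | mem g hg =>
      obtain ⟨k, rfl⟩ := hg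
      by_cases hk : k = 0
      · subst hk
        simp only [mFourier_zero, ContinuousMap.one_apply, integral_const, probReal_univ, one_smul]
        refine Filter.Tendsto.cesaro_smul tendsto_const_nhds
      · have h0 : ∫ z, mFourier k z = 0 := by
          have h1 := integral_add_left_eq_self (μ := (volume : Measure (UnitAddTorus ι)))
            (mFourier k) x
          simp only [mFourier_add_apply, integral_const_mul] at h1
          have h2 : (mFourier k x - 1) * ∫ z, mFourier k z = 0 := by rw [sub_mul, h1]; ring
          exact (mul_eq_zero.mp h2).resolve_left (sub_ne_zero.mpr (hx k hk))
        simp only [h0, mFourier_nsmul]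
        exact tendsto_geom_average_zero (norm_mFourier_apply k x) (hx k hk)
    | zero => simp
    | add g h _ _ hg hh =>
      simp only [ContinuousMap.add_apply, Finset.sum_add_distrib, smul_add]
      rw [integral_add (hint g) (hint h)]
      exact hg.add hh
    | smul c g _ hg =>
      simp only [ContinuousMap.smul_apply, ← Finset.smul_sum]
      rw [integral_smul]
      simpa only [smul_comm c] using hg.const_smul c
  have hdense : f ∈ closure (Submodule.span ℂ (range (mFourier (d := ι))) : Set _) := by
    rw [← Submodule.topologicalClosure_coe, span_mFourier_closure_eq_top]
    trivial
  rw [Metric.tendsto_atTop]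
  intro ε hε
  obtain ⟨g, hg, hfg⟩ := Metric.mem_closure_iff.mp hdense (ε / 3) (by positivity)
  obtain ⟨N₀, hN₀⟩ := Metric.tendsto_atTop.mp (hspan g hg) (ε / 3) (by positivity)
  have hpt : ∀ z, dist (f z) (g z) ≤ ε / 3 := fun z =>
    (ContinuousMap.dist_apply_le_dist z).trans hfg.le
  refine ⟨N₀, fun N hN => ?_⟩
  have h1 : dist ((N : ℝ)⁻¹ • ∑ n ∈ Finset.range N, f (n • x))
      ((N : ℝ)⁻¹ • ∑ n ∈ Finset.range N, g (n • x)) ≤ ε / 3 := by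
    rw [dist_smul₀, Real.norm_of_nonneg (by positivity)]
    calc (N : ℝ)⁻¹ * dist (∑ n ∈ Finset.range N, f (n • x)) (∑ n ∈ Finset.range N, g (n • x))
        ≤ (N : ℝ)⁻¹ * ∑ n ∈ Finset.range N, ε / 3 := by
          gcongr
          exact dist_sum_sum_le_of_le _ fun n _ => hpt _
      _ ≤ ε / 3 := by
          rw [Finset.sum_const, Finset.card_range, nsmul_eq_mul, ← mul_assoc]
          exact mul_le_of_le_one_left (by positivity) inv_mul_le_one
  have h2 : dist (∫ z, g z) (∫ z, f z) ≤ ε / 3 := by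
    rw [dist_eq_norm, ← integral_sub (hint g) (hint f)]
    refine (norm_integral_le_of_norm_le_const (C := ε / 3) (ae_of_all _ fun z => ?_)).trans ?_
    · rw [← dist_eq_norm, dist_comm]; exact hpt z
    · simp
  have := hN₀ N hN
  have := dist_triangle4 ((N : ℝ)⁻¹ • ∑ n ∈ Finset.range N, f (n • x))
    ((N : ℝ)⁻¹ • ∑ n ∈ Finset.range N, g (n • x)) (∫ z, g z) (∫ z, f z)
  linarith

open Topology in
/-- Kronecker's theorem on simultaneous approximation. -/
theorem UnitAddTorus.exists_nsmul_dist_lt {ι : Type*} [Fintype ι] (x : UnitAddTorus ι)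
    (hx : ∀ k : ι → ℤ, k ≠ 0 → mFourier k x ≠ 1) (t : UnitAddTorus ι) {ε : ℝ} (hε : 0 < ε)
    (N : ℕ) : ∃ n > N, dist (n • x) t < ε := by
  by_contra! h
  let g : UnitAddTorus ι → ℝ := fun z => max 0 (ε - dist z t)
  have hgc : Continuous g := by fun_prop
  let f : C(UnitAddTorus ι, ℂ) := ⟨fun z => (g z : ℂ), by fun_prop⟩
  have h0 : Tendsto (fun n : ℕ => f (n • x)) atTop (𝓝 0) := by
    refine tendsto_const_nhds.congr' ?_
    filter_upwards [eventually_gt_atTop N] with n hn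
    have : g (n • x) = 0 := max_eq_left (by linarith [h n hn])
    simp [f, this]
  have h1 := tendsto_nhds_unique (tendsto_average x hx f) h0.cesaro_smul
  have h2 : ∫ z, g z = 0 := by
    have : ∫ z, f z = ((∫ z, g z : ℝ) : ℂ) := integral_ofReal
    rw [this] at h1
    exact_mod_cast h1
  have h3 : 0 < ∫ z, g z :=
    hgc.integral_pos_of_hasCompactSupport_nonneg_nonzero (x := t)
      (HasCompactSupport.of_compactSpace _) (fun z => le_max_left _ _) (by simp [g, hε])
  exact h3.ne' h2

theorem exists_linearIndependent_cons_one {m : ℕ} (S : Fin m → Set ℝ)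
    (hS : ∀ i, ¬ (S i).Countable) :
    ∃ x : Fin m → ℝ, (∀ i, x i ∈ S i) ∧
      LinearIndependent ℚ (Fin.cons 1 x : Fin (m + 1) → ℝ) := by
  induction m with
  | zero =>
    refine ⟨Fin.elim0, fun i => i.elim0, ?_⟩
    rw [Fintype.linearIndependent_iff]
    intro g hg i
    fin_cases i
    simpa using hg
  | succ m ih =>
    obtain ⟨x, hxS, hx⟩ := ih (fun i => S i.castSucc) fun i => hS _
    have hc : (Submodule.span ℚ (range (Fin.cons 1 x : Fin (m + 1) → ℝ)) : Set ℝ).Countable :=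
      Set.countable_coe_iff.mp
        (inferInstanceAs (Countable (Submodule.span ℚ (range (Fin.cons 1 x : Fin (m + 1) → ℝ)))))
    obtain ⟨a, haS, ha⟩ : ∃ a ∈ S (Fin.last m),
        a ∉ (Submodule.span ℚ (range (Fin.cons 1 x : Fin (m + 1) → ℝ)) : Set ℝ) := by
      by_contra! hsub
      exact hS _ (hc.mono hsub)
    refine ⟨Fin.snoc x a, fun i => ?_, ?_⟩
    · refine Fin.lastCases ?_ (fun j => ?_) i
      · simpa using haS
      · simpa using hxS j
    · rw [Fin.cons_snoc_eq_snoc_cons, linearIndependent_finSnoc]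
      exact ⟨hx, ha⟩

theorem mFourier_coe_ne_one {m : ℕ} {x : Fin m → ℝ}
    (hx : LinearIndependent ℚ (Fin.cons 1 x : Fin (m + 1) → ℝ)) (k : Fin m → ℤ) (hk : k ≠ 0) :
    UnitAddTorus.mFourier k (fun i => (x i : UnitAddCircle)) ≠ 1 := by
  intro h
  have h1 : UnitAddTorus.mFourier k (fun i => (x i : UnitAddCircle)) =
      Complex.exp (2 * Real.pi * Complex.I * ∑ i, k i * x i) := by
    rw [Complex.ofReal_sum, Finset.mul_sum, Complex.exp_sum]
    simp only [UnitAddTorus.mFourier, ContinuousMap.coe_mk, fourier_coe_apply]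
    refine Finset.prod_congr rfl fun i _ => ?_
    congr 1
    push_cast
    ring
  rw [h1, Complex.exp_eq_one_iff] at h
  obtain ⟨l, hl⟩ := h
  have hl' : (∑ i, (k i : ℝ) * x i) = l := by
    have h2 : (2 * Real.pi * Complex.I : ℂ) ≠ 0 := Complex.two_pi_I_ne_zero
    have h3 := mul_left_cancel₀ h2 (hl.trans (mul_comm _ _))
    exact_mod_cast h3
  rw [Fintype.linearIndependent_iff] at hx
  have h4 := hx (Fin.cons (-l : ℚ) fun i => (k i : ℚ)) (by
    rw [Fin.sum_univ_succ]
    simp [Rat.smul_def, hl'])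
  exact hk (funext fun i => by simpa using h4 i.succ)

/-- From finitely many uncountable sets one can select points whose multiples by a single large
integer are close modulo one to prescribed targets. -/
theorem exists_mem_norm_nat_mul_sub_lt {ι : Type*} [Finite ι] (S : ι → Set ℝ)
    (hS : ∀ i, ¬ (S i).Countable) (t : ι → ℝ) {ε : ℝ} (hε : 0 < ε) (N : ℕ) :
    ∃ x : ι → ℝ, (∀ i, x i ∈ S i) ∧ ∃ n > N, ∀ i, ‖((n * x i - t i : ℝ) : UnitAddCircle)‖ < ε := by
  obtain ⟨m, ⟨e⟩⟩ := Finite.exists_equiv_fin ι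
  obtain ⟨x, hxS, hx⟩ := exists_linearIndependent_cons_one (fun j => S (e.symm j)) fun j => hS _
  obtain ⟨n, hn, hd⟩ := UnitAddTorus.exists_nsmul_dist_lt
    (fun j => (x j : UnitAddCircle)) (mFourier_coe_ne_one hx)
    (fun j => (t (e.symm j) : UnitAddCircle)) hε N
  refine ⟨fun i => x (e i), fun i => by simpa using hxS (e i), n, hn, fun i => ?_⟩
  have := (dist_pi_lt_iff hε).mp hd (e i)
  simpa [dist_eq_norm] using this

theorem nintDist_eq_norm (x : ℝ) : nintDist x = ‖(x : UnitAddCircle)‖ :=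
  UnitAddCircle.norm_eq.symm

theorem nintDist_nonneg (x : ℝ) : 0 ≤ nintDist x := abs_nonneg _

open Topology in
theorem exists_bound_of_summable_mul_norm_nsmul {b : ℕ → ℝ} (hb : ∀ n, 0 ≤ b n)
    (h : ∀ z : UnitAddCircle, Summable fun n => b n * ‖(n + 1) • z‖) :
    ∃ B : ℝ, ∀ z : UnitAddCircle, ∀ N, ∑ n ∈ Finset.range N, b n * ‖(n + 1) • z‖ ≤ B := by
  let F : ℕ → Set UnitAddCircle := fun M =>
    {z | ∀ N, ∑ n ∈ Finset.range N, b n * ‖(n + 1) • z‖ ≤ M}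
  have hF : ∀ M, IsClosed (F M) := fun M => by
    simp only [F, Set.ofPred_forall]
    exact isClosed_iInter fun N => isClosed_le (by fun_prop) continuous_const
  have hle : ∀ z N, ∑ n ∈ Finset.range N, b n * ‖(n + 1) • z‖ ≤ ∑' n, b n * ‖(n + 1) • z‖ :=
    fun z N => (h z).sum_le_tsum _ fun n _ => mul_nonneg (hb n) (norm_nonneg _)
  have hU : ⋃ M, F M = univ := by
    refine eq_univ_of_forall fun z => mem_iUnion.mpr ?_
    obtain ⟨M, hM⟩ := exists_nat_ge (∑' n, b n * ‖(n + 1) • z‖)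
    exact ⟨M, fun N => (hle z N).trans hM⟩
  obtain ⟨M, c, hc⟩ := nonempty_interior_of_iUnion_of_closed hF hU
  have hcompact : IsCompact (univ : Set UnitAddCircle) := isCompact_univ
  have hB : ∃ B : ℝ, ∀ z ∈ (univ : Set UnitAddCircle), ∀ N,
      ∑ n ∈ Finset.range N, b n * ‖(n + 1) • z‖ ≤ B := by
    refine hcompact.induction_on
      (p := fun s => ∃ B : ℝ, ∀ z ∈ s, ∀ N, ∑ n ∈ Finset.range N, b n * ‖(n + 1) • z‖ ≤ B)
      ⟨0, by simp⟩ ?_ ?_ ?_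
    · rintro s t hst ⟨B, hB⟩
      exact ⟨B, fun z hz => hB z (hst hz)⟩
    · rintro s t ⟨B, hB⟩ ⟨C, hC⟩
      refine ⟨max B C, fun z hz N => ?_⟩
      rcases hz with hz | hz
      · exact (hB z hz N).trans (le_max_left _ _)
      · exact (hC z hz N).trans (le_max_right _ _)
    · intro y _
      have hcont : ContinuousAt (fun z : UnitAddCircle => z - (y - c)) y := by fun_prop
      have hnhds : F M ∈ 𝓝 (y - (y - c)) := by
        rw [sub_sub_cancel]
        exact mem_interior_iff_mem_nhds.mp hc
      refine ⟨_, mem_nhdsWithin_of_mem_nhds (hcont hnhds),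
        M + ∑' n, b n * ‖(n + 1) • (y - c)‖, fun z hz N => ?_⟩
      calc ∑ n ∈ Finset.range N, b n * ‖(n + 1) • z‖
          ≤ ∑ n ∈ Finset.range N,
              (b n * ‖(n + 1) • (z - (y - c))‖ + b n * ‖(n + 1) • (y - c)‖) := by
            refine Finset.sum_le_sum fun n _ => ?_
            rw [← mul_add]
            refine mul_le_mul_of_nonneg_left ?_ (hb n)
            refine le_trans (le_of_eq ?_) (norm_add_le _ _)
            rw [← smul_add, sub_add_cancel]
        _ ≤ M + ∑' n, b n * ‖(n + 1) • (y - c)‖ := by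
            rw [Finset.sum_add_distrib]
            exact add_le_add (hz N) (hle _ N)
  obtain ⟨B, hB⟩ := hB
  exact ⟨B, fun z => hB z (mem_univ z)⟩

theorem integral_norm_succ_nsmul (n : ℕ) :
    ∫ z : UnitAddCircle, ‖(n + 1) • z‖ = ∫ z : UnitAddCircle, ‖z‖ := by
  have hmp : MeasurePreserving (fun z : UnitAddCircle => ((n + 1 : ℕ) : ℤ) • z) :=
    Measure.measurePreserving_zsmul volume (by omega)
  have := integral_map (f := fun z : UnitAddCircle => ‖z‖) hmp.aemeasurable
    continuous_norm.aestronglyMeasurable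
  rw [hmp.map_eq] at this
  simpa only [natCast_zsmul] using this.symm

/-- If `∑ bₙ ‖(n+1)z‖` converges everywhere on the circle, then `∑ bₙ` converges. -/
theorem summable_of_forall_summable_mul_norm_nsmul {b : ℕ → ℝ} (hb : ∀ n, 0 ≤ b n)
    (h : ∀ z : UnitAddCircle, Summable fun n => b n * ‖(n + 1) • z‖) : Summable b := by
  obtain ⟨B, hB⟩ := exists_bound_of_summable_mul_norm_nsmul hb h
  have hint : ∀ g : UnitAddCircle → ℝ, Continuous g → Integrable g := fun g hg =>
    hg.integrable_of_hasCompactSupport (HasCompactSupport.of_compactSpace _)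
  have hpos : 0 < ∫ z : UnitAddCircle, ‖z‖ := by
    refine continuous_norm.integral_pos_of_hasCompactSupport_nonneg_nonzero
      (x := ((1 / 2 : ℝ) : UnitAddCircle)) (HasCompactSupport.of_compactSpace _)
      (fun z => norm_nonneg z) ?_
    rw [UnitAddCircle.norm_eq]
    norm_num
  refine summable_of_sum_range_le (c := B / ∫ z : UnitAddCircle, ‖z‖) hb fun N => ?_
  rw [le_div_iff₀ hpos]
  calc (∑ n ∈ Finset.range N, b n) * ∫ z : UnitAddCircle, ‖z‖
      = ∫ z : UnitAddCircle, ∑ n ∈ Finset.range N, b n * ‖(n + 1) • z‖ := by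
        rw [integral_finsetSum _ fun n _ => hint _ (by fun_prop), Finset.sum_mul]
        simp only [integral_const_mul, integral_norm_succ_nsmul]
    _ ≤ ∫ _ : UnitAddCircle, B :=
        integral_mono (hint _ (by fun_prop)) (hint _ continuous_const) fun z => hB z N
    _ = B := by simp [Measure.real]

theorem not_isNSet_univ : ¬ IsNSet univ := by
  rintro ⟨a, ha, hns, h⟩
  refine hns ((summable_nat_add_iff 1).mp ?_)
  refine summable_of_forall_summable_mul_norm_nsmul (fun n => ha (n + 1)) fun z => ?_
  obtain ⟨y, rfl⟩ := QuotientAddGroup.mk_surjective z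
  have := (summable_nat_add_iff 1).mpr (h y (mem_univ y))
  simp only [nintDist_eq_norm] at this
  refine this.congr fun n => ?_
  rw [← nsmul_eq_mul]
  rfl

theorem IsNSet.mono {E F : Set ℝ} (hF : IsNSet F) (h : E ⊆ F) : IsNSet E := by
  obtain ⟨a, ha, hns, hs⟩ := hF
  exact ⟨a, ha, hns, fun x hx => hs x (h hx)⟩

open scoped Pointwise in
theorem IsNSet.add_self {E : Set ℝ} (hE : IsNSet E) : IsNSet (E + E) := by
  obtain ⟨a, ha, hns, hs⟩ := hE
  refine ⟨a, ha, hns, ?_⟩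
  rintro _ ⟨x, hx, y, hy, rfl⟩
  refine Summable.of_nonneg_of_le (fun n => mul_nonneg (ha n) (nintDist_nonneg _)) (fun n => ?_)
    ((hs x hx).add (hs y hy))
  rw [← mul_add]
  refine mul_le_mul_of_nonneg_left ?_ (ha n)
  simp only [nintDist_eq_norm, mul_add, AddCircle.coe_add]
  exact norm_add_le _ _

theorem IsDirichlet.isNSet {E : Set ℝ} (hE : IsDirichlet E) : IsNSet E := by
  obtain ⟨n, hn, h⟩ := hE
  refine ⟨(range n).indicator 1, indicator_nonneg fun _ _ => zero_le_one, fun hs => ?_,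
    fun x hx => ?_⟩
  · have h1 := hs.tendsto_atTop_zero.comp hn.tendsto_atTop
    have h2 : (range n).indicator (1 : ℕ → ℝ) ∘ n = fun _ => 1 := by
      ext k
      simp
    rw [h2] at h1
    exact one_ne_zero (tendsto_nhds_unique tendsto_const_nhds h1)
  · refine (hn.injective.summable_iff fun m hm => ?_).mp ?_
    · simp [indicator_of_notMem hm]
    · refine Summable.of_nonneg_of_le (fun k => ?_) (fun k => ?_) summable_geometric_two
      · simpa using nintDist_nonneg _
      · simpa using h x hx k

theorem norm_coe_unitAddCircle_le_abs (x : ℝ) : ‖(x : UnitAddCircle)‖ ≤ |x| := by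
  rw [UnitAddCircle.norm_eq]
  simpa using round_le x 0

theorem Perfect.not_countable_inter_ball {P : Set ℝ} (hP : Perfect P) {x r : ℝ} (hx : x ∈ P)
    (hr : 0 < r) : ¬ (P ∩ Metric.ball x r).Countable := by
  intro hc
  obtain ⟨hperf, hne⟩ := hP.closure_nhds_inter x hx (Metric.mem_ball_self (half_pos hr))
    Metric.isOpen_ball
  obtain ⟨f, hfr, -, hfi⟩ := hperf.exists_nat_bool_injection hne
  have hsub : closure (Metric.ball x (r / 2) ∩ P) ⊆ P ∩ Metric.ball x r := by
    intro z hz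
    refine ⟨closure_minimal inter_subset_right hP.closed hz, ?_⟩
    have : z ∈ Metric.closedBall x (r / 2) :=
      closure_minimal (inter_subset_left.trans Metric.ball_subset_closedBall)
        Metric.isClosed_closedBall hz
    exact Metric.closedBall_subset_ball (half_lt_self hr) this
  have h1 : (range f).Countable := hc.mono (hfr.trans hsub)
  have h2 : Countable (ℕ → Bool) := by
    have := h1.preimage_of_injOn (f := f) hfi.injOn
    rw [preimage_range] at this
    exact countable_univ_iff.mp this
  have h3 := Cardinal.mk_le_aleph0_iff.mpr h2
  simp only [Cardinal.mk_pi, Cardinal.mk_bool, Cardinal.prod_const, Cardinal.lift_id,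
    Cardinal.mk_nat] at h3
  exact (Cardinal.cantor _).not_ge h3

theorem exists_fin_norm_sub_div_le (M : ℕ) (y : ℝ) :
    ∃ j : Fin (M + 1), ‖((y - (j : ℕ) / (M + 1 : ℝ) : ℝ) : UnitAddCircle)‖ ≤ 1 / (M + 1) := by
  have hM : (0 : ℝ) < M + 1 := by positivity
  have h0 := Int.fract_nonneg y
  have h1 := Int.fract_lt_one y
  have hpos : 0 ≤ (M + 1) * Int.fract y := by positivity
  have hlt : ⌊(M + 1) * Int.fract y⌋₊ < M + 1 := by
    rw [Nat.floor_lt hpos]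
    push_cast
    nlinarith
  refine ⟨⟨_, hlt⟩, ?_⟩
  have hf1 := Nat.floor_le hpos
  have hf2 := Nat.lt_floor_add_one ((M + 1) * Int.fract y)
  set q : ℝ := (⌊(M + 1) * Int.fract y⌋₊ : ℝ)
  have hcoe : ((y - q / (M + 1 : ℝ) : ℝ) : UnitAddCircle) =
      ((Int.fract y - q / (M + 1) : ℝ) : UnitAddCircle) := by
    rw [← Int.self_sub_floor, AddCircle.coe_sub, AddCircle.coe_sub, AddCircle.coe_sub]
    have : ((⌊y⌋ : ℝ) : UnitAddCircle) = 0 :=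
      (AddCircle.coe_eq_zero_iff 1).mpr ⟨⌊y⌋, by simp⟩
    rw [this, sub_zero]
  rw [hcoe]
  refine (norm_coe_unitAddCircle_le_abs _).trans ?_
  rw [abs_le, le_sub_iff_add_le, sub_le_iff_le_add, ← add_div, le_div_iff₀ hM, neg_add_eq_sub,
    ← sub_div, div_le_iff₀ hM]
  constructor <;> linarith

/-- Refinement step: finitely many portions of a perfect set can be shrunk so that, for a single
large `n`, every real is within `ε` of the shrunk portions after multiplication by `n` modulo
one. -/
theorem Perfect.exists_refinement {P : Set ℝ} (hP : Perfect P) (F : Finset ℝ)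
    (hF : ∀ x ∈ F, x ∈ P) {r ε : ℝ} (hr : 0 < r) (hε : 0 < ε) (N : ℕ) :
    ∃ n > N, ∃ F' : Finset ℝ, (∀ x ∈ F', x ∈ P) ∧ ∃ r' > 0, ∀ y : ℝ, ∀ x ∈ F, ∃ x' ∈ F',
      Metric.closedBall x' r' ⊆ Metric.closedBall x r ∧
      ∀ z ∈ Metric.closedBall x' r', nintDist (n * (y - z)) ≤ ε := by
  classical
  obtain ⟨M, hM⟩ := exists_nat_one_div_lt (show 0 < ε / 3 by positivity)
  obtain ⟨p, hpS, n, hn, hp⟩ := exists_mem_norm_nat_mul_sub_lt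
    (ι := F × Fin (M + 1)) (fun i => P ∩ Metric.ball i.1 (r / 2))
    (fun i => hP.not_countable_inter_ball (hF _ i.1.2) (half_pos hr))
    (fun i => (i.2 : ℕ) / (M + 1 : ℝ)) (show 0 < ε / 3 by positivity) N
  have hn0 : (0 : ℝ) < n := by exact_mod_cast (Nat.zero_le N).trans_lt hn
  refine ⟨n, hn, Finset.univ.image p, ?_, min (r / 2) (ε / (3 * n)), by positivity, ?_⟩
  · simp only [Finset.mem_image, Finset.mem_univ, true_and]
    rintro _ ⟨i, rfl⟩
    exact (hpS i).1
  intro y x hx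
  obtain ⟨j, hj⟩ := exists_fin_norm_sub_div_le M (n * y)
  set i : F × Fin (M + 1) := (⟨x, hx⟩, j)
  refine ⟨p i, Finset.mem_image_of_mem _ (Finset.mem_univ _), ?_, fun z hz => ?_⟩
  · refine Metric.closedBall_subset_closedBall' ?_
    have h1 : dist (p i) x < r / 2 := (hpS i).2
    linarith [min_le_left (r / 2) (ε / (3 * n))]
  · have hz' : |p i - z| ≤ ε / (3 * n) := by
      rw [abs_sub_comm]
      exact (Metric.mem_closedBall.mp hz).trans (min_le_right _ _)
    have h1 : ‖((n * (p i - z) : ℝ) : UnitAddCircle)‖ ≤ ε / 3 := by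
      refine (norm_coe_unitAddCircle_le_abs _).trans ?_
      rw [abs_mul, abs_of_pos hn0]
      calc n * |p i - z| ≤ n * (ε / (3 * n)) := by gcongr
        _ = ε / 3 := by field_simp
    rw [nintDist_eq_norm, show (n * (y - z) : ℝ) = (n * y - (j : ℕ) / (M + 1 : ℝ)) -
      (n * p i - (j : ℕ) / (M + 1 : ℝ)) + n * (p i - z) by ring, AddCircle.coe_add,
      AddCircle.coe_sub]
    have h2 := norm_add_le
      (((n * y - (j : ℕ) / (M + 1 : ℝ) : ℝ) : UnitAddCircle) -
        ((n * p i - (j : ℕ) / (M + 1 : ℝ) : ℝ) : UnitAddCircle))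
      ((n * (p i - z) : ℝ) : UnitAddCircle)
    have h3 := norm_sub_le ((n * y - (j : ℕ) / (M + 1 : ℝ) : ℝ) : UnitAddCircle)
      ((n * p i - (j : ℕ) / (M + 1 : ℝ) : ℝ) : UnitAddCircle)
    have h4 := hp i
    linarith

open scoped Pointwise in
/-- Every nonempty perfect set has a Dirichlet set as complementary summand of the real line. -/
theorem Perfect.exists_isDirichlet_add_eq_univ {P : Set ℝ} (hP : Perfect P) (hne : P.Nonempty) :
    ∃ E : Set ℝ, IsDirichlet E ∧ P + E = univ := by
  obtain ⟨x₀, hx₀⟩ := hne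
  let State := {s : ℕ × Finset ℝ × ℝ // (∀ x ∈ s.2.1, x ∈ P) ∧ 0 < s.2.2}
  have hstep : ∀ (k : ℕ) (s : State), ∃ s' : State, s.1.1 < s'.1.1 ∧
      ∀ y : ℝ, ∀ x ∈ s.1.2.1, ∃ x' ∈ s'.1.2.1,
        Metric.closedBall x' s'.1.2.2 ⊆ Metric.closedBall x s.1.2.2 ∧
        ∀ z ∈ Metric.closedBall x' s'.1.2.2, nintDist (s'.1.1 * (y - z)) ≤ (1 / 2) ^ k := by
    rintro k ⟨⟨N, F, r⟩, hF, hr⟩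
    obtain ⟨n, hn, F', hF', r', hr', h⟩ :=
      hP.exists_refinement F hF hr (show (0 : ℝ) < (1 / 2) ^ k by positivity) N
    exact ⟨⟨⟨n, F', r'⟩, hF', hr'⟩, hn, h⟩
  choose next hlt hnext using hstep
  let s : ℕ → State := fun k =>
    Nat.rec ⟨⟨0, {x₀}, 1⟩, by simpa using hx₀, one_pos⟩ (fun k t => next k t) k
  have hs : ∀ k, s (k + 1) = next k (s k) := fun k => rfl
  refine ⟨{x | ∀ k, nintDist ((s (k + 1)).1.1 * x) ≤ (1 / 2) ^ k},
    ⟨fun k => (s (k + 1)).1.1, strictMono_nat_of_lt_succ fun k => hlt (k + 1) (s (k + 1)),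
      fun x hx => hx⟩, eq_univ_of_forall fun y => ?_⟩
  choose c hcF hcsub hcy using fun (k : ℕ) (x : {x // x ∈ (s k).1.2.1}) =>
    hnext k (s k) y x.1 x.2
  let u : ∀ k, {x // x ∈ (s k).1.2.1} := fun k =>
    Nat.rec ⟨x₀, Finset.mem_singleton_self x₀⟩ (fun k x => ⟨c k x, hcF k x⟩) k
  have hu : ∀ k, (u (k + 1)).1 = c k (u k) := fun k => rfl
  obtain ⟨z, hz⟩ := IsCompact.nonempty_iInter_of_sequence_nonempty_isCompact_isClosed
    (fun k => P ∩ Metric.closedBall (u k).1 (s k).1.2.2)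
    (fun k => inter_subset_inter_right P (hcsub k (u k)))
    (fun k => ⟨(u k).1, (s k).2.1 _ (u k).2, Metric.mem_closedBall_self (s k).2.2.le⟩)
    ((isCompact_closedBall _ _).inter_left hP.closed)
    (fun k => hP.closed.inter Metric.isClosed_closedBall)
  rw [mem_iInter] at hz
  exact ⟨z, (hz 0).1, y - z, fun k => hcy k (u k) z (hz (k + 1)).2, add_sub_cancel z y⟩

theorem stmt4 (P : Set ℝ) (hP : Perfect P) (hne : P.Nonempty) :
    ∃ E : Set ℝ, IsNSet E ∧ ¬ IsNSet (P ∪ E) := by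
  obtain ⟨E, hE, hPE⟩ := hP.exists_isDirichlet_add_eq_univ hne
  refine ⟨E, hE.isNSet, fun h => not_isNSet_univ ?_⟩
  exact hPE ▸ h.add_self.mono (Set.add_subset_add subset_union_left subset_union_right)
end
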